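/- Let n ≥ 2 and let N = {1,…,n} be partitioned into sets N_1 and N_2 with l = |N_1| satisfying 2 ≤ l < n. Let X = (X_i)_{i∈N} be a partition of M into pairwise disjoint bundles such that X_j is a singleton for each j ∈ N_2, and let M_1 = ⋃_{j∈N_1} X_j (so that v_i(M_1) = 1 − ∑_{j∈N_2} m_i(X_j)). Fix i ∈ N_1 and suppose: (a) v_i(X_i) ≥ v_i(M_1)/l − (1/(l−1)) ∑_{j∈N_1∖{i}} m_i(X_j); (b) m_i(X_j) < 1/n − (1/(n−1)) ∑_{j'∈N_2} m_i(X_{j'}) for every j ∈ N_1∖{i}. Then v_i(X_i) > 1/n − (1/(n−1)) ∑_{j∈N∖{i}} m_i(X_j), i.e., agent i is PROPavg-satisfied by X. -/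

import Mathlib

open Finset
open scoped Classical

noncomputable section

variable {G : Type*}

/-- Value of a bundle under an additive valuation. -/
def val (v : G → ℝ) (S : Finset G) : ℝ := ∑ g ∈ S, v g

/-- Minimum value of a good in a bundle; `0` for the empty bundle. -/
def minval (v : G → ℝ) (S : Finset G) : ℝ :=
  if h : S.Nonempty then S.inf' h v else 0

/-- `X` is a partition of the goods into `n` pairwise disjoint (possibly empty) bundles. -/
def IsAlloc {n : ℕ} (X : Fin n → Finset G) : Prop :=
  (∀ i j : Fin n, i ≠ j → Disjoint (X i) (X j)) ∧ (∀ g : G, ∃ i : Fin n, g ∈ X i)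

/-- Agent `i` is PROPavg-satisfied by the allocation `X`. -/
def PROPavgSat {n : ℕ} (v : Fin n → G → ℝ) (X : Fin n → Finset G) (i : Fin n) : Prop :=
  val (v i) (X i) + (1 / ((n : ℝ) - 1)) * ∑ k ∈ Finset.univ.erase i, minval (v i) (X k)
    ≥ 1 / (n : ℝ)

lemma minval_nonneg {v : G → ℝ} (hv : ∀ g, 0 ≤ v g) (S : Finset G) : 0 ≤ minval v S := by
  unfold minval
  split_ifs with h
  · exact Finset.le_inf' _ _ fun g _ => hv g
  · exact le_rfl

lemma minval_eq_val_of_card_eq_one (v : G → ℝ) {S : Finset G} (hS : S.card = 1) :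
    minval v S = val v S := by
  obtain ⟨g, rfl⟩ := Finset.card_eq_one.mp hS
  simp [minval, _root_.val]

lemma IsAlloc.sum_val [Fintype G] {n : ℕ} {X : Fin n → Finset G} (hX : IsAlloc X) (v : G → ℝ) :
    ∑ j, val v (X j) = val v Finset.univ := by
  have h : (Finset.univ : Finset G) = Finset.univ.biUnion X := by
    ext g
    simpa using hX.2 g
  rw [h]
  exact (Finset.sum_biUnion fun i _ j _ hij => hX.1 i j hij).symm

/-- The numerical inequality behind `case3_propavg`: `q` is the average of the minimum values over
the other bundles of `N₁`, and `s` is their sum over `N₂`. -/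
lemma propavg_bound {n l q s : ℝ} (hl : 2 ≤ l) (hln : l + 1 ≤ n) (hs : 0 ≤ s)
    (hq : q < 1 / n - 1 / (n - 1) * s) (hq0 : 0 ≤ q) :
    1 / n - 1 / (n - 1) * ((l - 1) * q + s) < (1 - s) / l - q := by
  have hn : 0 < n := by linarith
  have hn1 : 0 < n - 1 := by linarith
  have hl0 : 0 < l := by linarith
  obtain ⟨u, hu⟩ : ∃ u, u = 1 / n - 1 / (n - 1) * s := ⟨_, rfl⟩
  obtain ⟨w, hw⟩ : ∃ w, w = 1 / n := ⟨_, rfl⟩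
  have hnw : n * w = 1 := by rw [hw]; field_simp
  have hsu : s = (n - 1) * (w - u) := by rw [hu, hw]; field_simp; ring
  have huw : u ≤ w := by
    by_contra! h
    nlinarith
  rw [← hu] at hq
  have hlu : l * u ≤ (n - 1) * w := by
    have h₁ : l * u ≤ l * w := by gcongr
    have h₂ : l * w ≤ (n - 1) * w := by
      have : 0 ≤ w := by linarith
      gcongr
      linarith
    linarith
  have hqu : l * (n - l) * q < l * (n - l) * u :=
    mul_lt_mul_of_pos_left hq (mul_pos hl0 (by linarith))
  have hsq : 0 ≤ (n - 1 - l) ^ 2 * u := mul_nonneg (sq_nonneg _) (by linarith)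
  have key : 0 < (n - 1) * w + (n - 1) ^ 2 * u - l * (n - l) * q - l * (n - 1) * u := by
    nlinarith
  have heq : (1 - s) / l - q - (1 / n - 1 / (n - 1) * ((l - 1) * q + s)) =
      ((n - 1) * w + (n - 1) ^ 2 * u - l * (n - l) * q - l * (n - 1) * u) / (l * (n - 1)) := by
    rw [← hw, hsu]
    field_simp
    linear_combination (-(n - 1)) * hnw
  have := div_pos key (mul_pos hl0 hn1)
  linarith

/-- Case 3 computation in the proof of Lemma 7. -/
theorem case3_propavg {G : Type*} [Fintype G] [DecidableEq G] (n : ℕ) (hn : 2 ≤ n)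
    (v : Fin n → G → ℝ)
    (hpos : ∀ (i : Fin n) (g : G), 0 ≤ v i g)
    (hnorm : ∀ i : Fin n, val (v i) (Finset.univ : Finset G) = 1)
    (N1 N2 : Finset (Fin n)) (hdisj : Disjoint N1 N2) (hunion : N1 ∪ N2 = Finset.univ)
    (hl2 : 2 ≤ N1.card) (hln : N1.card < n)
    (X : Fin n → Finset G) (hX : IsAlloc X)
    (hsingle : ∀ j ∈ N2, (X j).card = 1)
    (M1 : Finset G) (hM1 : M1 = N1.biUnion X)
    (i : Fin n) (hi : i ∈ N1)
    (ha : val (v i) (X i) ≥ val (v i) M1 / (N1.card : ℝ)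
      - (1 / ((N1.card : ℝ) - 1)) * ∑ j ∈ N1.erase i, minval (v i) (X j))
    (hb : ∀ j ∈ N1.erase i,
      minval (v i) (X j) < 1 / (n : ℝ)
        - (1 / ((n : ℝ) - 1)) * ∑ j' ∈ N2, minval (v i) (X j')) :
    val (v i) (X i) > 1 / (n : ℝ)
      - (1 / ((n : ℝ) - 1)) * ∑ j ∈ Finset.univ.erase i, minval (v i) (X j) := by
  have hn' : (N1.card : ℝ) + 1 ≤ n := by exact_mod_cast hln
  have hl' : (2 : ℝ) ≤ N1.card := by exact_mod_cast hl2
  have hl1 : (0 : ℝ) < (N1.card : ℝ) - 1 := by linarith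
  have hM1val : val (v i) M1 = 1 - ∑ j ∈ N2, minval (v i) (X j) := by
    have h₁ : val (v i) M1 = ∑ j ∈ N1, val (v i) (X j) := by
      rw [hM1]
      exact Finset.sum_biUnion fun a _ b _ hab => hX.1 a b hab
    have h₂ : ∑ j ∈ N2, minval (v i) (X j) = ∑ j ∈ N2, val (v i) (X j) :=
      Finset.sum_congr rfl fun j hj => minval_eq_val_of_card_eq_one _ (hsingle j hj)
    rw [h₁, h₂, ← hnorm i, ← hX.sum_val, ← hunion, Finset.sum_union hdisj, add_sub_cancel_right]
  have hsum : ∑ j ∈ Finset.univ.erase i, minval (v i) (X j) =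
      ∑ j ∈ N1.erase i, minval (v i) (X j) + ∑ j ∈ N2, minval (v i) (X j) := by
    have hi2 : i ∉ N2 := Finset.disjoint_left.mp hdisj hi
    rw [← hunion, Finset.erase_union_distrib, Finset.erase_eq_of_notMem hi2,
      Finset.sum_union (hdisj.mono_left (Finset.erase_subset _ _))]
  have hcard : ((N1.erase i).card : ℝ) = N1.card - 1 := by
    rw [Finset.card_erase_of_mem hi, Nat.cast_sub (by omega), Nat.cast_one]
  have hne : (N1.erase i).Nonempty := by
    rw [← Finset.card_pos, Finset.card_erase_of_mem hi]
    omega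
  have hlt := Finset.sum_lt_sum_of_nonempty hne hb
  rw [Finset.sum_const, nsmul_eq_mul, hcard] at hlt
  have hS1 : 0 ≤ ∑ j ∈ N1.erase i, minval (v i) (X j) :=
    Finset.sum_nonneg fun j _ => minval_nonneg (hpos i) _
  have hS2 : 0 ≤ ∑ j ∈ N2, minval (v i) (X j) :=
    Finset.sum_nonneg fun j _ => minval_nonneg (hpos i) _
  have hbound := propavg_bound hl' hn' hS2 ((div_lt_iff₀' hl1).mpr hlt) (div_nonneg hS1 hl1.le)
  rw [mul_div_cancel₀ _ hl1.ne'] at hbound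
  rw [hM1val, one_div_mul_eq_div] at ha
  rw [hsum]
  exact hbound.trans_le ha
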